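/- Let Θ be a suitable set of moduli of continuity and let (g_n) be a sequence of weak Θ-Carathéodory functions converging to a weak Θ-Carathéodory function g in the σ_Θ sense. Then for each j ∈ ℕ, each compact interval I = [q₁,q₂] with rational endpoints, and all rationals p₁, p₂ with q₁ ≤ p₁ < p₂ ≤ q₂, one has lim_{n→∞} sup_{x ∈ K_j^I} |∫_{p₁}^{p₂} [g_n(t, x(t)) − g(t, x(t))] dt| = 0. -/

import Mathlib

open MeasureTheory Set Filter Topology
open scoped RealInnerProductSpace

noncomputable section

abbrev Euc (n : ℕ) := EuclideanSpace ℝ (Fin n)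

/-- A function `ℝ → ℝ` is locally integrable (w.r.t. Lebesgue measure) on every
compact interval. -/
def LocInt (m : ℝ → ℝ) : Prop := ∀ a b : ℝ, IntegrableOn m (Icc a b)

section Defs

variable {N : ℕ} {F : Type*} [NormedAddCommGroup F] [NormedSpace ℝ F]

/-- The Carathéodory conditions (C1) and (C2). -/
def IsCara (f : ℝ → Euc N → F) : Prop :=
  StronglyMeasurable (Function.uncurry f) ∧
  ∀ K : Set (Euc N), IsCompact K → ∃ m : ℝ → ℝ, (∀ t, 0 ≤ m t) ∧ LocInt m ∧
    ∀ᵐ t : ℝ, ∀ x ∈ K, ‖f t x‖ ≤ m t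

/-- A suitable set of moduli of continuity `Θ = {θ_j^{[q₁,q₂]}}`. -/
structure SuitableModuli where
  θ : ℕ → ℚ → ℚ → ℝ → ℝ
  nonneg : ∀ j q₁ q₂ s, (0:ℝ) ≤ s → 0 ≤ θ j q₁ q₂ s
  cont : ∀ j q₁ q₂, ContinuousOn (θ j q₁ q₂) (Ici 0)
  mono : ∀ j q₁ q₂, MonotoneOn (θ j q₁ q₂) (Ici 0)
  zero : ∀ j q₁ q₂, θ j q₁ q₂ 0 = 0
  ordered : ∀ j₁ j₂ q₁ q₂ p₁ p₂, j₁ ≤ j₂ → p₁ ≤ q₁ → q₂ ≤ p₂ →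
    ∀ s : ℝ, 0 ≤ s → θ j₁ q₁ q₂ s ≤ θ j₂ p₁ p₂ s

/-- `x ∈ K_j^{[q₁,q₂]}`: continuous, bounded by `j` and with modulus of continuity
`θ_j^{[q₁,q₂]}` on `[q₁,q₂]`. -/
def inK {N : ℕ} (Θ : SuitableModuli) (j : ℕ) (q₁ q₂ : ℚ) (x : ℝ → Euc N) : Prop :=
  ContinuousOn x (Icc (q₁:ℝ) (q₂:ℝ)) ∧
  (∀ t ∈ Icc (q₁:ℝ) (q₂:ℝ), ‖x t‖ ≤ (j:ℝ)) ∧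
  ∀ t ∈ Icc (q₁:ℝ) (q₂:ℝ), ∀ s ∈ Icc (q₁:ℝ) (q₂:ℝ), ‖x t - x s‖ ≤ Θ.θ j q₁ q₂ |t - s|

/-- Weak Θ-Carathéodory functions: Carathéodory conditions plus condition (W). -/
def IsWTC (Θ : SuitableModuli) (f : ℝ → Euc N → F) : Prop :=
  IsCara f ∧
  ∀ (j : ℕ) (q₁ q₂ : ℚ) (xs : ℕ → ℝ → Euc N) (x : ℝ → Euc N),
    (∀ n, inK Θ j q₁ q₂ (xs n)) → inK Θ j q₁ q₂ x →
    TendstoUniformlyOn (fun n t => xs n t) x atTop (Icc (q₁:ℝ) (q₂:ℝ)) →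
    Tendsto (fun n => ∫ t in Icc (q₁:ℝ) (q₂:ℝ), f t (xs n t)) atTop
      (𝓝 (∫ t in Icc (q₁:ℝ) (q₂:ℝ), f t (x t)))

/-- Convergence in the `σ_Θ` sense:
`sup_{x ∈ K_j^I} ‖∫_I (f_n(t,x(t)) − f(t,x(t))) dt‖ → 0` for every `j` and `I`. -/
def SigmaTendsto (Θ : SuitableModuli) (fs : ℕ → ℝ → Euc N → F) (f : ℝ → Euc N → F) : Prop :=
  ∀ (j : ℕ) (q₁ q₂ : ℚ), ∀ ε > (0:ℝ), ∀ᶠ n in atTop, ∀ x : ℝ → Euc N, inK Θ j q₁ q₂ x →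
    ‖∫ t in Icc (q₁:ℝ) (q₂:ℝ), (fs n t (x t) - f t (x t))‖ < ε

end Defs

/-- Lipschitz Carathéodory functions. -/
def IsLC {N : ℕ} (f : ℝ → Euc N → Euc N) : Prop :=
  IsCara f ∧
  ∀ K : Set (Euc N), IsCompact K → ∃ l : ℝ → ℝ, LocInt l ∧
    ∀ᵐ t : ℝ, ∀ x ∈ K, ∀ y ∈ K, ‖f t x - f t y‖ ≤ l t * ‖x - y‖

/-- The optimal m-bound of `f` on the closed ball `B_j`. -/
def mOpt {N : ℕ} (f : ℝ → Euc N → Euc N) (j : ℕ) (t : ℝ) : ℝ :=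
  sSup {v : ℝ | ∃ x : Euc N, ‖x‖ ≤ (j:ℝ) ∧ v = ‖f t x‖}

/-- The time translation `f_r(s,x) = f(s+r,x)`. -/
def timeTranslate {N : ℕ} (f : ℝ → Euc N → Euc N) (r : ℝ) : ℝ → Euc N → Euc N :=
  fun s x => f (s + r) x

/-- `x` is a solution of `ẋ = g(t,x)`, `x(0) = x₀`, defined on `[0,∞)`. -/
def IsSolOn {N : ℕ} (g : ℝ → Euc N → Euc N) (x₀ : Euc N) (x : ℝ → Euc N) : Prop :=
  ContinuousOn x (Ici 0) ∧ ∀ t ∈ Ici (0:ℝ), x t = x₀ + ∫ s in (0:ℝ)..t, g s (x s)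

/-- Along a continuous curve, a Carathéodory function is integrable on compact intervals. -/
lemma IsCara.integrableOn_comp {N : ℕ} {F : Type*} [NormedAddCommGroup F] [NormedSpace ℝ F]
    {f : ℝ → Euc N → F} (hf : IsCara f) {y : ℝ → Euc N} (hy : Continuous y) (a b : ℝ) :
    IntegrableOn (fun t => f t (y t)) (Icc a b) := by
  obtain ⟨m, -, hm, hfm⟩ := hf.2 (y '' Icc a b) (isCompact_Icc.image hy)
  refine (hm a b).mono' ?_ ?_
  · exact (hf.1.comp_measurable (measurable_id.prodMk hy.measurable)).aestronglyMeasurable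
  · filter_upwards [ae_restrict_of_ae hfm, ae_restrict_mem measurableSet_Icc] with t ht htI
    exact ht _ (mem_image_of_mem y htI)

lemma inK_const {N : ℕ} (Θ : SuitableModuli) {j : ℕ} (q₁ q₂ : ℚ) {c : Euc N} (hc : ‖c‖ ≤ j) :
    inK Θ j q₁ q₂ (fun _ => c) :=
  ⟨continuousOn_const, fun _ _ => hc, fun t _ s _ => by
    simpa using Θ.nonneg j q₁ q₂ |t - s| (abs_nonneg _)⟩

lemma abs_projIcc_sub_projIcc_le {a b : ℝ} (h : a ≤ b) (t s : ℝ) :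
    |(projIcc a b h t : ℝ) - projIcc a b h s| ≤ |t - s| := by
  simpa [Subtype.dist_eq, Real.dist_eq] using (LipschitzWith.projIcc h).dist_le_mul t s

/-- Freezing a curve outside a subinterval keeps it in the same set `K_j^I`. -/
lemma inK.comp_projIcc {N : ℕ} {Θ : SuitableModuli} {j : ℕ} {q₁ q₂ : ℚ} {x : ℝ → Euc N}
    (hx : inK Θ j q₁ q₂ x) {a b : ℝ} (h : a ≤ b) (ha : (q₁ : ℝ) ≤ a) (hb : b ≤ q₂) :
    Continuous (fun t => x (projIcc a b h t)) ∧
      inK Θ j q₁ q₂ (fun t => x (projIcc a b h t)) := by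
  have hmem : ∀ t, (projIcc a b h t : ℝ) ∈ Icc (q₁ : ℝ) q₂ := fun t =>
    Icc_subset_Icc ha hb (projIcc a b h t).2
  have hcont : Continuous (fun t => x (projIcc a b h t)) :=
    hx.1.comp_continuous (continuous_subtype_val.comp continuous_projIcc) hmem
  refine ⟨hcont, hcont.continuousOn, fun t _ => hx.2.1 _ (hmem t), fun t _ s _ => ?_⟩
  exact (hx.2.2 _ (hmem t) _ (hmem s)).trans
    (Θ.mono j q₁ q₂ (mem_Ici.2 (abs_nonneg _)) (mem_Ici.2 (abs_nonneg _))
      (abs_projIcc_sub_projIcc_le h t s))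

/-- If `g_n → g` in the `σ_Θ` sense, then the uniform (over `K_j^I`)
convergence of integrals also holds on rational subintervals `[p₁,p₂] ⊆ [q₁,q₂]`. -/
theorem stmt2 {N M : ℕ} (Θ : SuitableModuli)
    (gs : ℕ → ℝ → Euc N → Euc M) (g : ℝ → Euc N → Euc M)
    (hgs : ∀ n, IsWTC Θ (gs n)) (hg : IsWTC Θ g)
    (hconv : SigmaTendsto Θ gs g)
    (j : ℕ) (q₁ q₂ p₁ p₂ : ℚ) (h₁ : q₁ ≤ p₁) (h₂ : p₁ < p₂) (h₃ : p₂ ≤ q₂) :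
    ∀ ε > (0:ℝ), ∀ᶠ n in atTop, ∀ x : ℝ → Euc N, inK Θ j q₁ q₂ x →
      ‖∫ t in Icc (p₁:ℝ) (p₂:ℝ), (gs n t (x t) - g t (x t))‖ < ε := by
  intro ε hε
  have h₁' : (q₁ : ℝ) ≤ p₁ := by exact_mod_cast h₁
  have h₂' : (p₁ : ℝ) ≤ p₂ := by exact_mod_cast h₂.le
  have h₃' : (p₂ : ℝ) ≤ q₂ := by exact_mod_cast h₃
  have hε3 : 0 < ε / 3 := by positivity
  filter_upwards [hconv j q₁ q₂ _ hε3, hconv j q₁ p₁ _ hε3, hconv j p₂ q₂ _ hε3]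
    with n hn hn₁ hn₂ x hx
  obtain ⟨hyc, hyK⟩ := hx.comp_projIcc h₂' h₁' h₃'
  set y : ℝ → Euc N := fun t => x (projIcc (p₁ : ℝ) p₂ h₂' t) with hy
  have hint : ∀ a b : ℝ, a ≤ b →
      IntervalIntegrable (fun t => gs n t (y t) - g t (y t)) volume a b := fun a b hab =>
    (intervalIntegrable_iff_integrableOn_Icc_of_le hab).2
      (((hgs n).1.integrableOn_comp hyc a b).sub (hg.1.integrableOn_comp hyc a b))
  have hIcc : ∀ (a b : ℝ) (u : ℝ → Euc M), a ≤ b →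
      ∫ t in Icc a b, u t = ∫ t in a..b, u t := fun a b u hab => by
    rw [intervalIntegral.integral_of_le hab, integral_Icc_eq_integral_Ioc]
  have hsplit : ∫ t in Icc (p₁ : ℝ) p₂, (gs n t (y t) - g t (y t)) =
      (∫ t in Icc (q₁ : ℝ) q₂, (gs n t (y t) - g t (y t))) -
      (∫ t in Icc (q₁ : ℝ) p₁, (gs n t (y t) - g t (y t))) -
      (∫ t in Icc (p₂ : ℝ) q₂, (gs n t (y t) - g t (y t))) := by
    rw [hIcc _ _ _ h₁', hIcc _ _ _ h₂', hIcc _ _ _ h₃', hIcc _ _ _ (h₁'.trans (h₂'.trans h₃')),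
      ← intervalIntegral.integral_add_adjacent_intervals
        (hint _ _ (h₁'.trans h₂')) (hint _ _ h₃'),
      ← intervalIntegral.integral_add_adjacent_intervals (hint _ _ h₁') (hint _ _ h₂')]
    abel
  have hmid : ∫ t in Icc (p₁ : ℝ) p₂, (gs n t (x t) - g t (x t)) =
      ∫ t in Icc (p₁ : ℝ) p₂, (gs n t (y t) - g t (y t)) :=
    setIntegral_congr_fun measurableSet_Icc fun t ht => by
      simp only [hy, projIcc_of_mem h₂' ht]
  have hleft : ‖∫ t in Icc (q₁ : ℝ) p₁, (gs n t (y t) - g t (y t))‖ < ε / 3 := by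
    refine lt_of_eq_of_lt (congrArg _ (setIntegral_congr_fun measurableSet_Icc fun t ht => ?_))
      (hn₁ _ (inK_const Θ q₁ p₁ (hx.2.1 p₁ ⟨h₁', h₂'.trans h₃'⟩)))
    simp only [hy, projIcc_of_le_left h₂' ht.2]
  have hright : ‖∫ t in Icc (p₂ : ℝ) q₂, (gs n t (y t) - g t (y t))‖ < ε / 3 := by
    refine lt_of_eq_of_lt (congrArg _ (setIntegral_congr_fun measurableSet_Icc fun t ht => ?_))
      (hn₂ _ (inK_const Θ p₂ q₂ (hx.2.1 p₂ ⟨h₁'.trans h₂', h₃'⟩)))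
    simp only [hy, projIcc_of_right_le h₂' ht.1]
  rw [hmid, hsplit]
  refine (norm_sub_le _ _).trans_lt ?_
  linarith [norm_sub_le (∫ t in Icc (q₁ : ℝ) q₂, (gs n t (y t) - g t (y t)))
    (∫ t in Icc (q₁ : ℝ) p₁, (gs n t (y t) - g t (y t))), hn y hyK]
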